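/- arXiv:2208.03893 — 2 statements merged into one kernel-verified Lean document; each statement's English description precedes it below -/
import Mathlib

section
/- Let P be a complex vector space equipped with linear operators X and D satisfying D∘X - X∘D = id, such that the only subspaces of P invariant under both X and D are 0 and P (i.e., P is a simple module over the Weyl algebra). Let V be a simple module over the Lie algebra 𝔟, and suppose there is l ∈ ℤ>0 such that d_l acts injectively on V and d_i V = 0 for all i > l. Then the action on P ⊗ V given by d_{-1}·(p⊗v) = Dp ⊗ v and d_m·(p⊗v) = X^{m+1}Dp ⊗ v + Σ_{r=0}^{m} binom(m+1, r+1) X^{m-r}p ⊗ d_r·v for m ∈ ℤ≥0 defines a 𝔚-module structure T(P,V), and T(P,V) is a simple 𝔚-module. -/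
/-!
The Witt algebra `𝔚` of vector fields on the line has basis `{d_i : i ≥ -1}` with
`[d_i, d_j] = (j - i) d_{i+j}`, and `𝔟 = span{d_i : i ≥ 0}`.  Since `𝔚` (resp. `𝔟`) is
free as a vector space on the `d_i`, a `𝔚`-module (resp. `𝔟`-module) structure on a
complex vector space is exactly a family of endomorphisms satisfying the commutator
relations.  A module over the rank-one Weyl algebra is a vector space `P` with operators
`X`, `D` satisfying `D ∘ X - X ∘ D = 1`.
-/

noncomputable section

open TensorProduct

/-- The action maps of the tensor module `T(P,V)` on `P ⊗ V`:
`d_{-1}·(p ⊗ v) = Dp ⊗ v` and, for `m ≥ 0`,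
`d_m·(p ⊗ v) = X^{m+1}D p ⊗ v + ∑_{r=0}^{m} C(m+1, r+1) X^{m-r} p ⊗ d_r v`,
where `b r` is the action of `d_r` on the `𝔟`-module `V`. -/
def Td {P V : Type} [AddCommGroup P] [Module ℂ P] [AddCommGroup V] [Module ℂ V]
    (X D : Module.End ℂ P) (b : ℕ → Module.End ℂ V) (i : ℤ) :
    Module.End ℂ (P ⊗[ℂ] V) :=
  if i < 0 then TensorProduct.map D LinearMap.id
  else
    TensorProduct.map (X ^ (i.toNat + 1) * D) LinearMap.id +
      ∑ r ∈ Finset.range (i.toNat + 1),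
        (((i.toNat + 1).choose (r + 1) : ℂ)) • TensorProduct.map (X ^ (i.toNat - r)) (b r)

open Polynomial in
theorem hasseDeriv_derivative {R : Type*} [CommRing R] (k : ℕ) (f : R[X]) :
    hasseDeriv k (derivative f) = (k + 1 : R) • hasseDeriv (k + 1) f := by
  have h := LinearMap.congr_fun (hasseDeriv_comp (R := R) k 1) f
  simpa [hasseDeriv_one, ← Nat.cast_smul_eq_nsmul R] using h

open Polynomial in
theorem derivative_hasseDeriv {R : Type*} [CommRing R] (k : ℕ) (f : R[X]) :
    derivative (hasseDeriv k f) = (k + 1 : R) • hasseDeriv (k + 1) f := by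
  have h := LinearMap.congr_fun (hasseDeriv_comp (R := R) 1 k) f
  simpa [hasseDeriv_one, ← Nat.cast_smul_eq_nsmul R, add_comm 1 k] using h

open Polynomial Finset in
/-- The divided derivatives of the Wronskian `f g' - f' g`. -/
theorem hasseDeriv_wronskian {R : Type*} [CommRing R] (k : ℕ) (f g : R[X]) :
    hasseDeriv (k + 1) (f * derivative g - derivative f * g) =
      (k + 2 : R) • (f * hasseDeriv (k + 2) g) - (k + 2 : R) • (g * hasseDeriv (k + 2) f) +
      ∑ p ∈ antidiagonal k,
        ((p.2 : R) - p.1) • (hasseDeriv (p.1 + 1) f * hasseDeriv (p.2 + 1) g) := by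
  have h1 : hasseDeriv (k + 1) (f * derivative g) = ∑ p ∈ antidiagonal (k + 2),
      (p.2 : R) • (hasseDeriv p.1 f * hasseDeriv p.2 g) := by
    rw [Finset.Nat.sum_antidiagonal_succ', hasseDeriv_mul]
    simp [hasseDeriv_derivative]
  have h2 : hasseDeriv (k + 1) (derivative f * g) = ∑ p ∈ antidiagonal (k + 2),
      (p.1 : R) • (hasseDeriv p.1 f * hasseDeriv p.2 g) := by
    rw [Finset.Nat.sum_antidiagonal_succ, hasseDeriv_mul]
    simp [hasseDeriv_derivative]
  rw [map_sub, h1, h2, ← Finset.sum_sub_distrib, Finset.Nat.sum_antidiagonal_succ,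
    Finset.Nat.sum_antidiagonal_succ']
  simp only [← sub_smul, hasseDeriv_zero', Nat.cast_add, Nat.cast_one, Nat.cast_zero,
    add_sub_add_right_eq_sub, zero_sub, sub_zero, neg_smul, mul_comm _ g]
  module

section Operators

open Polynomial Finset

variable {K E : Type*} [Field K] [Ring E] [Algebra K E]

/-- The operator `∑ i, (f⁽ⁱ⁾ / i!)(x) γᵢ` attached to a polynomial vector field `f ∂`. -/
def fieldOp (x : E) (γ : ℕ → E) (N : ℕ) : K[X] →ₗ[K] E :=
  ∑ i ∈ range N, LinearMap.mulRight K (γ i) ∘ₗ (aeval x).toLinearMap ∘ₗ hasseDeriv i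

theorem fieldOp_apply (x : E) (γ : ℕ → E) (N : ℕ) (f : K[X]) :
    fieldOp x γ N f = ∑ i ∈ range N, aeval x (hasseDeriv i f) * γ i := by
  simp [fieldOp]

theorem mul_aeval_of_weyl {x d : E} (h : d * x - x * d = 1) (g : K[X]) :
    d * aeval x g = aeval x g * d + aeval x (derivative g) := by
  have hx : d * x = x * d + 1 := by rw [← h]; abel
  induction g using Polynomial.induction_on' with
  | add p q hp hq => simp only [map_add, mul_add, hp, hq, add_mul]; abel
  | monomial n a =>
    have key : ∀ n : ℕ, d * x ^ n = x ^ n * d + (n : K) • x ^ (n - 1) := by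
      intro n
      induction n with
      | zero => simp
      | succ n ih =>
        rw [pow_succ, ← mul_assoc, ih, add_mul, mul_assoc, hx]
        rcases n with _ | n
        · simp
        · simp only [Nat.add_sub_cancel, smul_mul_assoc, ← pow_succ, mul_add, mul_one, ← mul_assoc]
          push_cast
          module
    simp only [derivative_monomial, aeval_monomial]
    rw [← mul_assoc, ← Algebra.commutes, mul_assoc, key, mul_add, mul_assoc]
    simp [Algebra.smul_def, mul_assoc]

variable {x : E} {γ : ℕ → E}

theorem commute_aeval {y : E} (h : Commute x y) (g : K[X]) : Commute (aeval x g) y := by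
  induction g using Polynomial.induction_on' with
  | add p q hp hq => simpa using hp.add_left hq
  | monomial n a =>
    simpa [aeval_monomial] using Commute.mul_left (Algebra.commutes a y) (h.pow_left n)

theorem fieldOp_mul_aeval (N : ℕ) (h0 : γ 0 * x - x * γ 0 = 1)
    (hc : ∀ i, Commute x (γ (i + 1))) (f g : K[X]) :
    fieldOp x γ (N + 1) f * aeval x g =
      aeval x g * fieldOp x γ (N + 1) f + aeval x (f * derivative g) := by
  have hs : ∀ i, γ (i + 1) * aeval x g = aeval x g * γ (i + 1) := fun i ↦
    (commute_aeval (hc i) g).symm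
  simp only [fieldOp_apply, sum_range_succ', add_mul, mul_add, Finset.sum_mul, mul_assoc, hs,
    mul_aeval_of_weyl h0, Finset.mul_sum, hasseDeriv_zero', map_mul]
  simp only [← mul_assoc, ← map_mul, mul_comm g]
  abel

theorem fieldOp_mul (N : ℕ) (h0 : γ 0 * x - x * γ 0 = 1)
    (hc : ∀ i, Commute x (γ (i + 1))) (f g : K[X]) :
    fieldOp x γ (N + 1) f * fieldOp x γ (N + 1) g =
      ∑ i ∈ range (N + 1), ∑ j ∈ range (N + 1),
        aeval x (hasseDeriv i f * hasseDeriv j g) * (γ i * γ j) +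
      ∑ j ∈ range (N + 1), (j + 1 : K) • (aeval x (f * hasseDeriv (j + 1) g) * γ j) := by
  rw [fieldOp_apply _ _ _ g, Finset.mul_sum]
  simp only [← mul_assoc, fieldOp_mul_aeval N h0 hc, add_mul, sum_add_distrib,
    derivative_hasseDeriv]
  congr 1
  · rw [sum_comm]
    simp only [fieldOp_apply, Finset.sum_mul, Finset.mul_sum, ← mul_assoc, ← map_mul]
    simp only [mul_comm]
  · simp

theorem fieldOp_commutator (N : ℕ) (h0 : γ 0 * x - x * γ 0 = 1)
    (hc : ∀ i, Commute x (γ (i + 1))) (hd : ∀ i, Commute (γ 0) (γ (i + 1)))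
    (hb : ∀ r s : ℕ, γ (r + 1) * γ (s + 1) - γ (s + 1) * γ (r + 1) =
      ((s : K) - r) • γ (r + s + 1))
    (hN : ∀ i, N ≤ i → γ (i + 1) = 0) (f g : K[X]) :
    fieldOp x γ (N + 1) f * fieldOp x γ (N + 1) g - fieldOp x γ (N + 1) g * fieldOp x γ (N + 1) f =
      fieldOp x γ (N + 1) (f * derivative g - derivative f * g) := by
  have hsum : ∑ i ∈ range (N + 1), ∑ j ∈ range (N + 1),
        aeval x (hasseDeriv i f * hasseDeriv j g) * (γ i * γ j) -
      ∑ i ∈ range (N + 1), ∑ j ∈ range (N + 1),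
        aeval x (hasseDeriv i g * hasseDeriv j f) * (γ i * γ j) =
      ∑ k ∈ range N, ∑ p ∈ antidiagonal k, ((p.2 : K) - p.1) •
        (aeval x (hasseDeriv (p.1 + 1) f * hasseDeriv (p.2 + 1) g) * γ (k + 1)) := by
    rw [sum_comm (f := fun i j ↦ aeval x (hasseDeriv i g * hasseDeriv j f) * (γ i * γ j))]
    simp only [← sum_sub_distrib, mul_comm (hasseDeriv _ g), ← mul_sub]
    simp only [sum_range_succ' _ N, (hd _).eq, sub_self, mul_zero, sum_const_zero, add_zero, hb]
    simp only [Finset.Nat.sum_antidiagonal_eq_sum_range_succ_mk, Nat.succ_eq_add_one]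
    have := sum_range_diag_flip N (fun r s : ℕ ↦ ((s : K) - r) •
        (aeval x (hasseDeriv (r + 1) f * hasseDeriv (s + 1) g) * γ (r + s + 1)))
    refine Eq.trans ?_ (this.symm.trans ?_)
    · refine sum_congr rfl fun r hr ↦ ?_
      rw [← sum_subset (range_subset_range.2 (Nat.sub_le N r))]
      · simp
      · intro s hs hs'
        rw [hN (r + s) (by simp at hs'; omega)]
        simp
    · refine sum_congr rfl fun k hk ↦ sum_congr rfl fun r hr ↦ ?_
      rw [mem_range] at hr
      rw [Nat.add_sub_cancel' (by omega : r ≤ k)]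
  rw [fieldOp_mul N h0 hc, fieldOp_mul N h0 hc, add_sub_add_comm, hsum, fieldOp_apply]
  simp only [sum_range_succ' _ N, hasseDeriv_wronskian]
  simp only [hasseDeriv_zero', hasseDeriv_one', mul_comm (derivative f),
    map_add, map_sub, map_sum, map_smul, add_mul, sub_mul,
    Finset.sum_mul, sum_add_distrib, smul_mul_assoc, zero_add, Nat.cast_zero, one_smul,
    Nat.cast_add, Nat.cast_one, add_assoc, one_add_one_eq_two, sum_sub_distrib]
  abel

end Operators

section MixedDifference

open Polynomial Finset

variable (K : Type*) {M M' : Type*} [Field K] [AddCommGroup M] [Module K M]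
  [AddCommGroup M'] [Module K M']

/-- The effect on `G u v = B (X ^ u) (X ^ v)`, for a bilinear `B`, of multiplying the arguments of
`B` by `x - y`. -/
def mixedDiff : Module.End K (ℕ → ℕ → M) where
  toFun G u v := G (u + 1) v - G u (v + 1)
  map_add' G H := by ext u v; simp only [Pi.add_apply]; abel
  map_smul' c G := by ext u v; simp [smul_sub]

theorem mixedDiff_apply (G : ℕ → ℕ → M) (u v : ℕ) :
    mixedDiff K G u v = G (u + 1) v - G u (v + 1) := rfl

theorem mixedDiff_pow_compLeft (L : M →ₗ[K] M') (n : ℕ) (G : ℕ → ℕ → M) :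
    (mixedDiff K ^ n) ((L.compLeft ℕ).compLeft ℕ G) =
      (L.compLeft ℕ).compLeft ℕ ((mixedDiff K ^ n) G) := by
  induction n generalizing G with
  | zero => rfl
  | succ n ih =>
    rw [pow_succ, pow_succ, Module.End.mul_apply, Module.End.mul_apply, ← ih]
    congr 1
    ext u v
    simp [mixedDiff_apply]

theorem mixedDiff_pow_mem (S : Submodule K M) {G : ℕ → ℕ → M} (hG : ∀ u v, G u v ∈ S) (n : ℕ) :
    ∀ u v, (mixedDiff K ^ n) G u v ∈ S := by
  induction n with
  | zero => exact hG
  | succ n ih =>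
    intro u v
    rw [pow_succ', Module.End.mul_apply, mixedDiff_apply]
    exact S.sub_mem (ih _ _) (ih _ _)

/-- The product of the `i`-th and `j`-th divided derivatives of `X ^ u` and `X ^ v`. -/
def hassePair (i j u v : ℕ) : K[X] := hasseDeriv i (X ^ u) * hasseDeriv j (X ^ v)

theorem hasseDeriv_succ_X_pow_succ (k u : ℕ) :
    hasseDeriv (k + 1) (X ^ (u + 1) : K[X]) =
      X * hasseDeriv (k + 1) (X ^ u) + hasseDeriv k (X ^ u) := by
  have hX : ∀ i, hasseDeriv (i + 1 + 1) (X : K[X]) = 0 := fun i ↦ hasseDeriv_X _ (by omega)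
  rw [pow_succ', hasseDeriv_mul, Finset.Nat.sum_antidiagonal_succ]
  cases k with
  | zero => simp
  | succ k => rw [Finset.Nat.sum_antidiagonal_succ]; simp [hX]

theorem mixedDiff_hassePair_zero_zero : mixedDiff K (hassePair K 0 0) = 0 := by
  ext1 u; ext1 v
  simp only [mixedDiff_apply, hassePair, hasseDeriv_zero', Pi.zero_apply]
  ring

theorem mixedDiff_hassePair_zero_succ (j : ℕ) :
    mixedDiff K (hassePair K 0 (j + 1)) = - hassePair K 0 j := by
  ext1 u; ext1 v
  simp only [mixedDiff_apply, hassePair, hasseDeriv_zero', hasseDeriv_succ_X_pow_succ,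
    Pi.neg_apply]
  ring

theorem mixedDiff_hassePair_succ_zero (i : ℕ) :
    mixedDiff K (hassePair K (i + 1) 0) = hassePair K i 0 := by
  ext1 u; ext1 v
  simp only [mixedDiff_apply, hassePair, hasseDeriv_zero', hasseDeriv_succ_X_pow_succ]
  ring

theorem mixedDiff_hassePair_succ_succ (i j : ℕ) :
    mixedDiff K (hassePair K (i + 1) (j + 1)) =
      hassePair K i (j + 1) - hassePair K (i + 1) j := by
  ext1 u; ext1 v
  simp only [mixedDiff_apply, hassePair, hasseDeriv_succ_X_pow_succ, Pi.sub_apply]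
  ring

theorem mixedDiff_pow_hassePair_of_lt {n i j : ℕ} (h : i + j < n) :
    (mixedDiff K ^ n) (hassePair K i j) = 0 := by
  induction n generalizing i j with
  | zero => omega
  | succ n ih =>
    rw [pow_succ, Module.End.mul_apply]
    rcases i with _ | i <;> rcases j with _ | j
    · rw [mixedDiff_hassePair_zero_zero, map_zero]
    · rw [mixedDiff_hassePair_zero_succ, map_neg, ih (by omega), neg_zero]
    · rw [mixedDiff_hassePair_succ_zero, ih (by omega)]
    · rw [mixedDiff_hassePair_succ_succ, map_sub, ih (by omega), ih (by omega), sub_zero]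

theorem mixedDiff_pow_hassePair (i j : ℕ) :
    (mixedDiff K ^ (i + j)) (hassePair K i j) =
      ((-1) ^ j * ((i + j).choose j : K)) • hassePair K 0 0 := by
  induction h : i + j generalizing i j with
  | zero =>
    obtain ⟨rfl, rfl⟩ : i = 0 ∧ j = 0 := by omega
    simp
  | succ n ih =>
    rw [pow_succ, Module.End.mul_apply]
    rcases i with _ | i <;> rcases j with _ | j
    · omega
    · rw [mixedDiff_hassePair_zero_succ, map_neg, ih 0 j (by omega)]
      obtain rfl : n = j := by omega
      simp [pow_succ]
    · rw [mixedDiff_hassePair_succ_zero, ih i 0 (by omega)]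
      simp
    · rw [mixedDiff_hassePair_succ_succ, map_sub, ih i (j + 1) (by omega),
        ih (i + 1) j (by omega), ← sub_smul, Nat.choose_succ_succ]
      congr 1
      push_cast
      ring

variable {K}

/-- Quadratic expressions in the operators of a representation by vector fields contain the
operators `x ^ a γ_N ^ 2`, where `γ_N` is the top coefficient. -/
theorem pow_mul_sq_mem_of_fieldOp_mem [CharZero K] {E : Type*} [Ring E] [Algebra K E] {x : E}
    {γ : ℕ → E} {N : ℕ} (hN : 2 ≤ N) (h0 : γ 0 * x - x * γ 0 = 1)
    (hc : ∀ i, Commute x (γ (i + 1))) (S : Subalgebra K E)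
    (hS : ∀ f : K[X], fieldOp x γ (N + 1) f ∈ S) (a : ℕ) : x ^ a * γ N ^ 2 ∈ S := by
  let G : ℕ → ℕ → E := fun u v ↦
    fieldOp x γ (N + 1) (X ^ u : K[X]) * fieldOp x γ (N + 1) (X ^ v : K[X])
  let L (y : E) : K[X] →ₗ[K] E := LinearMap.mulRight K y ∘ₗ (aeval x).toLinearMap
  have hG : G = ∑ i ∈ range (N + 1), ∑ j ∈ range (N + 1),
        ((L (γ i * γ j)).compLeft ℕ).compLeft ℕ (hassePair K i j) +
      ∑ j ∈ range (N + 1),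
        (j + 1 : K) • ((L (γ j)).compLeft ℕ).compLeft ℕ (hassePair K 0 (j + 1)) := by
    ext u v
    simp only [G, fieldOp_mul N h0 hc, Pi.add_apply, Finset.sum_apply, Pi.smul_apply]
    simp [L, hassePair, mul_assoc]
  have hmem := mixedDiff_pow_mem K (Subalgebra.toSubmodule S) (G := G)
    (fun u v ↦ S.mul_mem (hS _) (hS _)) (N + N) a 0
  have hval : (mixedDiff K ^ (N + N)) G =
      ((-1) ^ N * ((N + N).choose N : K)) •
        ((L (γ N * γ N)).compLeft ℕ).compLeft ℕ (hassePair K 0 0) := by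
    rw [hG, map_add, map_sum, map_sum]
    simp only [map_sum, map_smul, mixedDiff_pow_compLeft]
    rw [sum_eq_single N, sum_eq_single N, mixedDiff_pow_hassePair, map_smul, sum_eq_zero, add_zero]
    · intro j hj
      rw [mem_range] at hj
      rw [mixedDiff_pow_hassePair_of_lt _ (by omega), map_zero, smul_zero]
    · intro j hj hj'
      rw [mem_range] at hj
      rw [mixedDiff_pow_hassePair_of_lt _ (by omega), map_zero]
    · simp
    · intro i hi hi'
      refine sum_eq_zero fun j hj ↦ ?_
      rw [mem_range] at hi hj
      rw [mixedDiff_pow_hassePair_of_lt _ (by omega), map_zero]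
    · simp
  rw [hval] at hmem
  have hne : ((-1) ^ N * ((N + N).choose N : K)) ≠ 0 :=
    mul_ne_zero (pow_ne_zero _ (by simp))
      (Nat.cast_ne_zero.2 (Nat.choose_pos (Nat.le_add_right N N)).ne')
  have h := (Submodule.smul_mem_iff _ hne).1 hmem
  simpa [L, hassePair, sq, mul_assoc] using h

end MixedDifference

section Stabilizer

open Polynomial Finset

/-- The algebra of operators preserving a subspace. -/
def stabilizerAlgebra {K W : Type*} [CommRing K] [AddCommGroup W] [Module K W]
    (U : Submodule K W) : Subalgebra K (Module.End K W) where
  carrier := {T | ∀ t ∈ U, T t ∈ U}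
  mul_mem' := fun hS hT t ht ↦ hS _ (hT t ht)
  add_mem' := fun hS hT t ht ↦ U.add_mem (hS t ht) (hT t ht)
  algebraMap_mem' := fun c _ ht ↦ U.smul_mem c ht

variable {K E : Type*} [Field K] [Ring E] [Algebra K E]

theorem coeff_mem_of_fieldOp_mem {x : E} {γ : ℕ → E} {N : ℕ} (hγ : ∀ i, N ≤ i → γ (i + 1) = 0)
    (S : Subalgebra K E) (hx : x ∈ S) (hS : ∀ f : K[X], fieldOp x γ (N + 1) f ∈ S) (i : ℕ) :
    γ i ∈ S := by
  induction i using Nat.strong_induction_on with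
  | _ i ih =>
    rcases lt_or_ge N i with hi | hi
    · obtain ⟨k, rfl⟩ : ∃ k, i = k + 1 := ⟨i - 1, by omega⟩
      rw [hγ k (by omega)]
      exact S.zero_mem
    · have h := hS (X ^ i)
      have hmem : ∀ f : K[X], aeval x f ∈ S := fun f ↦
        Algebra.adjoin_le (Set.singleton_subset_iff.2 hx) (aeval_mem_adjoin_singleton K x)
      rw [fieldOp_apply, ← add_sum_erase _ _ (mem_range.2 (Nat.lt_succ_of_le hi))] at h
      have hrest : ∑ j ∈ (range (N + 1)).erase i,
          aeval x (hasseDeriv j (X ^ i : K[X])) * γ j ∈ S := by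
        refine S.sum_mem fun j hj ↦ ?_
        rcases lt_or_ge i j with hij | hij
        · have hj0 : hasseDeriv j (X ^ i : K[X]) = 0 :=
            hasseDeriv_eq_zero_of_lt_natDegree _ _ (by rwa [natDegree_X_pow])
          rw [hj0, map_zero, zero_mul]
          exact S.zero_mem
        · exact S.mul_mem (hmem _) (ih j (lt_of_le_of_ne hij (ne_of_mem_erase hj)))
      have h1 : hasseDeriv i (X ^ i : K[X]) = 1 := by
        rw [← monomial_one_right_eq_X_pow, hasseDeriv_monomial]
        simp
      simpa [h1] using S.sub_mem h hrest

variable {W : Type*} [AddCommGroup W] [Module K W]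

/-- A nonzero subspace invariant under vector fields with injective top coefficient contains a
nonzero subspace invariant under all the coefficients as well. -/
theorem exists_le_coeff_invariant [CharZero K] {x : Module.End K W} {γ : ℕ → Module.End K W}
    {N : ℕ} (hN : 2 ≤ N) (h0 : γ 0 * x - x * γ 0 = 1) (hc : ∀ i, Commute x (γ (i + 1)))
    (hγ : ∀ i, N ≤ i → γ (i + 1) = 0) (hinj : Function.Injective (γ N)) (U : Submodule K W)
    (hU : U ≠ ⊥) (hS : ∀ f : K[X], fieldOp x γ (N + 1) f ∈ stabilizerAlgebra U) :
    ∃ U' ≤ U, U' ≠ ⊥ ∧ x ∈ stabilizerAlgebra U' ∧ ∀ i, γ i ∈ stabilizerAlgebra U' := by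
  let U' : Submodule K W := ⨅ g : K[X], U.comap (aeval x g)
  have hU' : ∀ t, t ∈ U' ↔ ∀ g : K[X], aeval x g t ∈ U := by simp [U', Submodule.mem_iInf]
  have hx : x ∈ stabilizerAlgebra U' := by
    intro t ht
    rw [hU'] at ht ⊢
    intro g
    have h := ht (g * X)
    rwa [map_mul, aeval_X] at h
  refine ⟨U', fun t ht ↦ by simpa using (hU' t).1 ht 1, ?_, hx,
    coeff_mem_of_fieldOp_mem hγ _ hx ?_⟩
  · obtain ⟨u, hu, hu0⟩ := U.ne_bot_iff.1 hU
    refine U'.ne_bot_iff.2 ⟨(γ N ^ 2) u, (hU' _).2 fun g ↦ ?_, ?_⟩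
    · rw [← Module.End.mul_apply]
      refine (?_ : aeval x g * γ N ^ 2 ∈ stabilizerAlgebra U) u hu
      induction g using Polynomial.induction_on' with
      | add p q hp hq => simpa [add_mul] using Subalgebra.add_mem _ hp hq
      | monomial n a =>
        rw [aeval_monomial, mul_assoc, ← Algebra.smul_def]
        exact Subalgebra.smul_mem _ (pow_mul_sq_mem_of_fieldOp_mem hN h0 hc _ hS n) a
    · rw [sq, Module.End.mul_apply]
      rwa [Ne, map_eq_zero_iff _ hinj, map_eq_zero_iff _ hinj]
  · intro f t ht
    rw [hU'] at ht ⊢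
    intro g
    have h := LinearMap.congr_fun (fieldOp_mul_aeval N h0 hc f g) t
    rw [LinearMap.add_apply, Module.End.mul_apply, Module.End.mul_apply] at h
    rw [← sub_eq_iff_eq_add.2 h]
    exact U.sub_mem (hS f _ (ht g)) (ht _)

end Stabilizer

section Schur

open Polynomial Cardinal

/-- An operator with empty spectrum on a nonzero space produces a linearly independent family
indexed by the field. -/
theorem linearIndependent_of_sub_apply_eq {K M : Type*} [Field K] [IsAlgClosed K]
    [AddCommGroup M] [Module K M] (e : Module.End K M)
    (he : ∀ c : K, IsUnit (e - algebraMap K _ c)) {p : M} (hp : p ≠ 0) (w : K → M)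
    (hw : ∀ c, (e - algebraMap K _ c) (w c) = p) : LinearIndependent K w := by
  classical
  have hinj : ∀ q : K[X], aeval e q p = 0 → q = 0 := by
    intro q hq
    by_contra hq0
    have hu : IsUnit (aeval e (q.roots.map fun a ↦ X - C a).prod) := by
      by_contra hnu
      obtain ⟨c, hc, -⟩ := spectrum.exists_mem_of_not_isUnit_aeval_prod hnu
      rw [spectrum.mem_iff, ← IsUnit.sub_iff] at hc
      exact hc (he c)
    rw [(IsAlgClosed.splits q).eq_prod_roots, map_mul, Module.End.mul_apply, aeval_C,
      Module.algebraMap_end_apply, smul_eq_zero, leadingCoeff_eq_zero] at hq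
    have hb := ((Module.End.isUnit_iff _).1 hu).injective
    exact hp (hb ((hq.resolve_left hq0).trans (map_zero _).symm))
  refine linearIndependent_iff'.2 fun s m hm i hi ↦ ?_
  have hq := hinj (∑ j ∈ s, C (m j) * ∏ k ∈ s.erase j, (X - C k)) <| by
    have h := congrArg (aeval e (∏ k ∈ s, (X - C k))) hm
    rw [map_sum, map_zero] at h
    rw [← h, map_sum, LinearMap.sum_apply]
    refine Finset.sum_congr rfl fun j hj ↦ ?_
    rw [← Finset.prod_erase_mul _ _ hj, map_mul, map_mul, Module.End.mul_apply,
      Module.End.mul_apply, map_smul,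
      show aeval e (X - C j) (w j) = p by rw [← hw j]; simp, map_smul, aeval_C,
      Module.algebraMap_end_apply]
  have h := congrArg (eval i) hq
  rw [eval_finsetSum, Finset.sum_eq_single i] at h
  · rw [eval_mul, eval_C, eval_prod, eval_zero, mul_eq_zero, Finset.prod_eq_zero_iff] at h
    refine h.resolve_right ?_
    rintro ⟨k, hk, h⟩
    rw [eval_sub, eval_X, eval_C, sub_eq_zero] at h
    exact (Finset.ne_of_mem_erase hk) h.symm
  · intro j _ hji
    rw [eval_mul, eval_prod, Finset.prod_eq_zero (Finset.mem_erase.2 ⟨hji.symm, hi⟩), mul_zero]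
    simp
  · exact fun h ↦ absurd hi h

/-- **Dixmier's version of Schur's lemma**: endomorphisms of a simple module of dimension less than
the cardinality of an algebraically closed field are scalars. -/
theorem IsSimpleModule.algebraMap_end_surjective_of_rank_lt.{u, v, w} {K : Type u}
    {R : Type v} {M : Type w} [Field K]
    [IsAlgClosed K] [Ring R] [Algebra K R] [AddCommGroup M] [Module K M] [Module R M]
    [IsScalarTower K R M] [IsSimpleModule R M]
    (h : Cardinal.lift.{u} (Module.rank K M) < Cardinal.lift.{w} #K) :
    Function.Surjective (algebraMap K (Module.End R M)) := by
  intro e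
  by_contra! hne
  have hb : ∀ c : K, Function.Bijective (e - algebraMap K (Module.End R M) c) := fun c ↦
    LinearMap.bijective_of_ne_zero fun h0 ↦ hne c (sub_eq_zero.1 h0).symm
  have := IsSimpleModule.nontrivial R M
  obtain ⟨p, hp⟩ := exists_ne (0 : M)
  choose w hw using fun c ↦ (hb c).surjective p
  have hli := linearIndependent_of_sub_apply_eq (e.restrictScalars K)
    (fun c ↦ (Module.End.isUnit_iff _).2 (hb c)) hp w hw
  exact absurd hli.cardinal_lift_le_rank (not_le.2 h)

end Schur

section TensorSimple

open Cardinal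

theorem Submonoid.countable_closure {M : Type*} [Monoid M] {s : Set M} (hs : s.Countable) :
    (Submonoid.closure s : Set M).Countable := by
  have := hs.to_subtype
  rw [Submonoid.closure_eq_mrange]
  exact Set.countable_range _

/-- A module generated by one vector over a countably generated algebra has countable dimension. -/
theorem rank_le_aleph0_of_adjoin_countable {K M : Type*} [Field K] [AddCommGroup M] [Module K M]
    {s : Set (Module.End K M)} (hs : s.Countable) [IsSimpleModule (Algebra.adjoin K s) M] :
    Module.rank K M ≤ ℵ₀ := by
  have := IsSimpleModule.nontrivial (Algebra.adjoin K s) M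
  obtain ⟨p, hp⟩ := exists_ne (0 : M)
  let c : Set M := (fun a : Module.End K M ↦ a p) '' (Submonoid.closure s : Set _)
  have hc : Submodule.span K c = ⊤ := by
    rw [eq_top_iff]
    rintro q -
    obtain ⟨⟨a, ha⟩, rfl⟩ := IsSimpleModule.toSpanSingleton_surjective (Algebra.adjoin K s) hp q
    have ha' : a ∈ Submodule.span K (Submonoid.closure s : Set (Module.End K M)) := by
      rwa [← Algebra.adjoin_eq_span]
    have := Submodule.mem_map_of_mem (f := LinearMap.applyₗ p) ha'
    rwa [Submodule.map_span] at this
  rw [← rank_top, ← hc]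
  refine (rank_span_le c).trans ?_
  exact ((Submonoid.countable_closure hs).image _).le_aleph0

/-- If `M` is simple of small dimension over the algebra `A` of operators and `N` is simple over
a family of operators, then `M ⊗ N` is simple under both. -/
theorem tensor_eq_top_of_invariant.{u, v, w, z} {K : Type u} {M : Type v} {N : Type w}
    {ι : Type z} [Field K] [IsAlgClosed K] [AddCommGroup M]
    [Module K M] [AddCommGroup N] [Module K N] (A : Subalgebra K (Module.End K M))
    [IsSimpleModule A M] (hrank : Cardinal.lift.{u} (Module.rank K M) < Cardinal.lift.{v} #K)
    (b : ι → Module.End K N)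
    (hN : ∀ U : Submodule K N, (∀ r, ∀ v ∈ U, b r v ∈ U) → U = ⊥ ∨ U = ⊤)
    (U : Submodule K (M ⊗[K] N)) (hU : U ≠ ⊥) (hA : ∀ a ∈ A, ∀ t ∈ U, a.rTensor N t ∈ U)
    (hb : ∀ r, ∀ t ∈ U, (b r).lTensor M t ∈ U) : U = ⊤ := by
  classical
  obtain ⟨u, huU, hu0⟩ := U.ne_bot_iff.1 hU
  let B := Module.Basis.ofVectorSpace K M
  obtain ⟨n, rfl⟩ := TensorProduct.eq_repr_basis_left B u
  obtain ⟨i, hi⟩ : ∃ i, n i ≠ 0 := by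
    by_contra! h
    exact hu0 (by simp [Finsupp.sum, h])
  have hschur := IsSimpleModule.algebraMap_end_surjective_of_rank_lt (R := A) hrank
  let f : Module.End (Module.End A M) M :=
    { toFun := fun m ↦ B.coord i m • B i
      map_add' := fun x y ↦ by simp [add_smul]
      map_smul' := fun e m ↦ by
        obtain ⟨c, rfl⟩ := hschur e
        simp [mul_smul] }
  obtain ⟨a, ha⟩ := jacobson_density f (n.support.image B)
  have hpure : B i ⊗ₜ[K] n i ∈ U := by
    have h := hA a a.2 _ huU
    rw [Finsupp.sum, map_sum, Finset.sum_eq_single i] at h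
    · rw [LinearMap.rTensor_tmul] at h
      have := ha (B i) (Finset.mem_image_of_mem _ (Finsupp.mem_support_iff.2 hi))
      rw [show a.1 (B i) = a • B i from rfl, ← this] at h
      simpa [f] using h
    · intro j hj hji
      have := ha (B j) (Finset.mem_image_of_mem _ hj)
      rw [LinearMap.rTensor_tmul, show a.1 (B j) = a • B j from rfl, ← this]
      simp [f, hji]
    · exact fun h ↦ absurd hi (by simpa using h)
  let V : Submodule K N := ⨅ p : M, U.comap (TensorProduct.mk K M N p)
  have hV : ∀ v, v ∈ V ↔ ∀ p : M, p ⊗ₜ[K] v ∈ U := by simp [V, Submodule.mem_iInf]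
  have hiV : n i ∈ V := by
    rw [hV]
    intro p
    obtain ⟨a, rfl⟩ := IsSimpleModule.toSpanSingleton_surjective A (B.ne_zero i) p
    exact hA a a.2 _ hpure
  have hVtop : V = ⊤ := by
    refine (hN V fun r v hv ↦ ?_).resolve_left fun h ↦ hi ?_
    · rw [hV] at hv ⊢
      exact fun p ↦ hb r _ (hv p)
    · rwa [h, Submodule.mem_bot] at hiV
  rw [eq_top_iff, ← TensorProduct.span_tmul_eq_top, Submodule.span_le]
  rintro _ ⟨p, v, rfl⟩
  exact (hV v).1 (hVtop ▸ Submodule.mem_top) p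

end TensorSimple

section TensorModule

open Polynomial Finset

variable {P V : Type} [AddCommGroup P] [Module ℂ P] [AddCommGroup V] [Module ℂ V]

/-- The coefficients of the action of vector fields on the tensor module. -/
def tensorCoeff (D : Module.End ℂ P) (b : ℕ → Module.End ℂ V) : ℕ → Module.End ℂ (P ⊗[ℂ] V)
  | 0 => D.rTensor V
  | r + 1 => (b r).lTensor P

theorem Td_eq_fieldOp (X' D : Module.End ℂ P) (b : ℕ → Module.End ℂ V) (l : ℕ)
    (hzero : ∀ i : ℕ, l < i → b i = 0) (a : ℕ) :
    Td X' D b ((a : ℤ) - 1) =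
      fieldOp (X'.rTensor V) (tensorCoeff D b) (l + 1 + 1) (X ^ a : ℂ[X]) := by
  have hpow : ∀ k, (X'.rTensor V) ^ k = (X' ^ k).rTensor V := X'.rTensor_pow
  rw [fieldOp_apply, sum_range_succ']
  rcases a with _ | m
  · rw [sum_eq_zero]
    · simp [Td, tensorCoeff, LinearMap.rTensor]
    · intro i _
      rw [pow_zero, hasseDeriv_apply_one _ (Nat.succ_pos i), map_zero, zero_mul]
  · have hm : ((m + 1 : ℕ) : ℤ) - 1 = m := by push_cast; ring
    have hterm : ∀ r, aeval (X'.rTensor V) (hasseDeriv (r + 1) (X ^ (m + 1) : ℂ[X])) *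
        tensorCoeff D b (r + 1) =
        ((m + 1).choose (r + 1) : ℂ) • TensorProduct.map (X' ^ (m - r)) (b r) := by
      intro r
      rw [← monomial_one_right_eq_X_pow, hasseDeriv_monomial, aeval_monomial,
        ← Algebra.smul_def, hpow, mul_one, smul_mul_assoc, Nat.add_sub_add_right, tensorCoeff,
        Module.End.mul_eq_comp, LinearMap.rTensor_comp_lTensor]
    simp only [hterm]
    rw [hm, Td, if_neg (by omega), Int.toNat_natCast, add_comm]
    congr 1
    · have h1 := sum_subset (range_subset_range.2 (Nat.le_add_right (m + 1) (l + 1)))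
        (f := fun r ↦ ((m + 1).choose (r + 1) : ℂ) • TensorProduct.map (X' ^ (m - r)) (b r)) <| by
          intro r _ hr
          rw [Nat.choose_eq_zero_of_lt (by simpa using hr)]
          simp
      have h2 := sum_subset (range_subset_range.2 (Nat.le_add_left (l + 1) (m + 1)))
        (f := fun r ↦ ((m + 1).choose (r + 1) : ℂ) • TensorProduct.map (X' ^ (m - r)) (b r)) <| by
          intro r _ hr
          rw [hzero r (by simpa using hr)]
          simp
      rw [h1, h2]
    · rw [hasseDeriv_zero', map_pow, aeval_X, hpow, tensorCoeff, ← LinearMap.rTensor_mul]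
      rfl

theorem X_pow_wronskian (a c : ℕ) :
    (X ^ a * derivative (X ^ c) - derivative (X ^ a) * X ^ c : ℂ[X]) =
      ((c : ℂ) - a) • X ^ (a + c - 1) := by
  rcases a with _ | a <;> rcases c with _ | c
  · simp
  · simp [smul_eq_C_mul]
  · simp [smul_eq_C_mul]
    ring
  · rw [show a + 1 + (c + 1) - 1 = a + c + 1 by omega]
    simp only [derivative_X_pow, smul_eq_C_mul, Nat.add_sub_cancel]
    simp only [map_sub, map_natCast]
    ring

theorem isSimpleModule_adjoin_of_invariant {K M : Type*} [Field K] [AddCommGroup M] [Module K M]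
    (s : Set (Module.End K M)) (hne : ∃ p : M, p ≠ 0)
    (hs : ∀ U : Submodule K M, (∀ a ∈ s, ∀ p ∈ U, a p ∈ U) → U = ⊥ ∨ U = ⊤) :
    IsSimpleModule (Algebra.adjoin K s) M := by
  have : Nontrivial M := nontrivial_iff_exists_ne 0 |>.2 hne
  rw [isSimpleModule_iff]
  refine { eq_bot_or_eq_top := fun U ↦ ?_ }
  refine (hs (U.restrictScalars K) fun a ha p hp ↦ ?_).imp ?_ ?_
  · exact U.smul_mem (⟨a, Algebra.subset_adjoin ha⟩ : Algebra.adjoin K s) hp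
  · exact (Submodule.restrictScalars_eq_bot_iff K _ _).1
  · exact (Submodule.restrictScalars_eq_top_iff K _ _).1

end TensorModule

/-- Let `P` be a simple module over the rank-one Weyl algebra (given by
operators `X`, `D` with `DX - XD = 1`), and let `V` be a simple `𝔟`-module (given by
operators `b r`, the actions of `d_r`, `r ≥ 0`) such that for some `l > 0` the operator
`d_l` acts injectively on `V` and `d_i V = 0` for `i > l`.  Then the maps `Td` define a
`𝔚`-module structure `T(P,V)` on `P ⊗ V` (the commutator relations of `𝔚` hold), and
`T(P,V)` is a simple `𝔚`-module. -/
theorem tensor_module_simple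
    (P : Type) [AddCommGroup P] [Module ℂ P] (X D : Module.End ℂ P)
    (hWeyl : D * X - X * D = 1)
    (hPne : ∃ p : P, p ≠ 0)
    (hPsimple : ∀ U : Submodule ℂ P,
      (∀ p ∈ U, X p ∈ U) → (∀ p ∈ U, D p ∈ U) → U = ⊥ ∨ U = ⊤)
    (V : Type) [AddCommGroup V] [Module ℂ V] (b : ℕ → Module.End ℂ V)
    (hb : ∀ r s : ℕ, b r * b s - b s * b r = (((s : ℂ) - (r : ℂ))) • b (r + s))
    (hVne : ∃ v : V, v ≠ 0)
    (hVsimple : ∀ U : Submodule ℂ V, (∀ r : ℕ, ∀ v ∈ U, b r v ∈ U) → U = ⊥ ∨ U = ⊤)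
    (l : ℕ) (hl : 0 < l)
    (hinj : Function.Injective (b l))
    (hzero : ∀ i : ℕ, l < i → b i = 0) :
    (∀ i j : ℤ, -1 ≤ i → -1 ≤ j →
      Td X D b i * Td X D b j - Td X D b j * Td X D b i
        = (((j : ℂ) - (i : ℂ))) • Td X D b (i + j)) ∧
    (∃ t : P ⊗[ℂ] V, t ≠ 0) ∧
    (∀ U : Submodule ℂ (P ⊗[ℂ] V),
      (∀ i : ℤ, -1 ≤ i → ∀ t ∈ U, Td X D b i t ∈ U) → U = ⊥ ∨ U = ⊤) := by
  have h0 : tensorCoeff D b 0 * X.rTensor V - X.rTensor V * tensorCoeff D b 0 = 1 := by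
    rw [tensorCoeff, ← LinearMap.rTensor_mul, ← LinearMap.rTensor_mul, ← LinearMap.rTensor_sub,
      hWeyl, Module.End.one_eq_id, LinearMap.rTensor_id, Module.End.one_eq_id]
  have hcomm : ∀ (a : Module.End ℂ P) (c : Module.End ℂ V),
      Commute (a.rTensor V) (c.lTensor P) := fun a c ↦ by
    rw [Commute, SemiconjBy, Module.End.mul_eq_comp, Module.End.mul_eq_comp,
      LinearMap.rTensor_comp_lTensor, LinearMap.lTensor_comp_rTensor]
  have hc : ∀ i, Commute (X.rTensor V) (tensorCoeff D b (i + 1)) := fun i ↦ hcomm X (b i)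
  have hd : ∀ i, Commute (tensorCoeff D b 0) (tensorCoeff D b (i + 1)) := fun i ↦ hcomm D (b i)
  have hbr : ∀ r s : ℕ, tensorCoeff D b (r + 1) * tensorCoeff D b (s + 1) -
      tensorCoeff D b (s + 1) * tensorCoeff D b (r + 1) =
        ((s : ℂ) - r) • tensorCoeff D b (r + s + 1) := fun r s ↦ by
    simp only [tensorCoeff]
    rw [← LinearMap.lTensor_mul, ← LinearMap.lTensor_mul, ← LinearMap.lTensor_sub, hb,
      LinearMap.lTensor_smul]
  have hγ : ∀ i, l + 1 ≤ i → tensorCoeff D b (i + 1) = 0 := fun i hi ↦ by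
    rw [tensorCoeff, hzero i hi, LinearMap.lTensor_zero]
  refine ⟨fun i j hi hj ↦ ?_, ?_, fun U hU ↦ ?_⟩
  · obtain ⟨a, rfl⟩ : ∃ a : ℕ, i = a - 1 := ⟨(i + 1).toNat, by omega⟩
    obtain ⟨c, rfl⟩ : ∃ c : ℕ, j = c - 1 := ⟨(j + 1).toNat, by omega⟩
    rw [Td_eq_fieldOp X D b l hzero, Td_eq_fieldOp X D b l hzero,
      fieldOp_commutator _ h0 hc hd hbr hγ, X_pow_wronskian, map_smul]
    rcases Nat.eq_zero_or_pos (a + c) with h | h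
    · obtain ⟨rfl, rfl⟩ : a = 0 ∧ c = 0 := by omega
      simp
    · rw [show (a : ℤ) - 1 + (c - 1) = ((a + c - 1 : ℕ) : ℤ) - 1 by omega,
        Td_eq_fieldOp X D b l hzero]
      congr 1
      push_cast
      ring
  · have : Nontrivial P := (nontrivial_iff_exists_ne 0).2 hPne
    have : Nontrivial V := (nontrivial_iff_exists_ne 0).2 hVne
    exact exists_ne 0
  · by_cases hbot : U = ⊥
    · exact Or.inl hbot
    have hS : ∀ f : Polynomial ℂ, fieldOp (X.rTensor V) (tensorCoeff D b) (l + 1 + 1) f ∈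
        stabilizerAlgebra U := fun f ↦ by
      induction f using Polynomial.induction_on' with
      | add p q hp hq => rw [map_add]; exact Subalgebra.add_mem _ hp hq
      | monomial n a =>
        rw [← mul_one a, ← smul_eq_mul, ← Polynomial.smul_monomial, map_smul,
          Polynomial.monomial_one_right_eq_X_pow, ← Td_eq_fieldOp X D b l hzero]
        have h : Td X D b ((n : ℤ) - 1) ∈ stabilizerAlgebra U := hU _ (by omega)
        exact (stabilizerAlgebra U).smul_mem h a
    obtain ⟨U', hle, hne, hX, hγU⟩ := exists_le_coeff_invariant (by omega) h0 hc hγ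
      (Module.Flat.lTensor_preserves_injective_linearMap _ hinj) U hbot hS
    have hsimple : IsSimpleModule (Algebra.adjoin ℂ {X, D}) P :=
      isSimpleModule_adjoin_of_invariant _ hPne fun W hW ↦
        hPsimple W (hW X (by simp)) (hW D (by simp))
    have hrank : Module.rank ℂ P < Cardinal.mk ℂ :=
      (rank_le_aleph0_of_adjoin_countable (Set.toFinite {X, D}).countable).trans_lt <| by
        rw [Cardinal.mk_complex]
        exact Cardinal.aleph0_lt_continuum
    refine Or.inr (top_le_iff.1 (le_trans (top_le_iff.2 ?_) hle))
    refine tensor_eq_top_of_invariant (Algebra.adjoin ℂ {X, D}) (by simpa using hrank) b hVsimple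
      U' hne ?_ fun r ↦ hγU (r + 1)
    have hA : Algebra.adjoin ℂ {X, D} ≤
        (stabilizerAlgebra U').comap (Module.End.rTensorAlgHom ℂ P V) := by
      rw [Algebra.adjoin_le_iff]
      rintro _ (rfl | rfl)
      · exact hX
      · exact hγU 0
    exact hA

end
end

section
/- Let P and P' be complex vector spaces equipped with linear operators X, D (respectively X', D') satisfying D∘X - X∘D = id (resp. D'∘X' - X'∘D' = id), each simple as a module over the Weyl algebra (the only subspaces invariant under both operators are 0 and the whole space). Let V and V' be simple 𝔟-modules such that for some l, s ∈ ℤ>0, d_l acts injectively on V with d_i V = 0 for i > l, and d_s acts injectively on V' with d_i V' = 0 for i > s. Then the 𝔚-modules T(P,V) and T(P',V') (with action d_{-1}·(p⊗v) = Dp ⊗ v, d_m·(p⊗v) = X^{m+1}Dp ⊗ v + Σ_{r=0}^{m} binom(m+1, r+1) X^{m-r}p ⊗ d_r·v) are isomorphic if and only if P ≅ P' as Weyl algebra modules, l = s, and V ≅ V' as 𝔟-modules. -/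
/-!
The Witt algebra `𝔚` of vector fields on the line has basis `{d_i : i ≥ -1}` with
`[d_i, d_j] = (j - i) d_{i+j}`, and `𝔟 = span{d_i : i ≥ 0}`.  Since `𝔚` (resp. `𝔟`) is
free as a vector space on the `d_i`, a `𝔚`-module (resp. `𝔟`-module) structure on a
complex vector space is exactly a family of endomorphisms satisfying the commutator
relations.  A module over the rank-one Weyl algebra is a vector space `P` with operators
`X`, `D` satisfying `D ∘ X - X ∘ D = 1`.
-/

noncomputable section

open TensorProduct

section Coefficients

open Finset Polynomial

/-- The coefficients of the `M`-th finite difference of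
`i ↦ (M - i).choose a * (i + c).choose b`. -/
def alternatingChooseSum (M c a b : ℕ) : ℂ :=
  ∑ i ∈ range (M + 1),
    (-1) ^ i * (M.choose i : ℂ) * (((M - i).choose a : ℂ) * ((i + c).choose b : ℂ))

lemma exists_polynomial_eval_choose (a : ℕ) :
    ∃ p : ℂ[X], p.natDegree ≤ a ∧ ∀ n : ℕ, p.eval (n : ℂ) = (n.choose a : ℂ) := by
  refine ⟨C ((a.factorial : ℂ)⁻¹) * descPochhammer ℂ a, ?_, fun n => ?_⟩
  · refine (natDegree_C_mul_le _ _).trans ?_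
    rw [descPochhammer_natDegree]
  · have h : (a.factorial : ℂ) ≠ 0 := by exact_mod_cast a.factorial_ne_zero
    rw [eval_C_mul, descPochhammer_eval_eq_descFactorial, Nat.descFactorial_eq_factorial_mul_choose]
    push_cast
    field_simp

lemma sum_alternating_choose_mul_eval_eq_zero {M : ℕ} {p : ℂ[X]} (hp : p.natDegree < M) :
    ∑ i ∈ range (M + 1), (-1) ^ i * (M.choose i : ℂ) * p.eval (i : ℂ) = 0 := by
  have h := congrFun (fwdDiff_iter_eq_zero_of_degree_lt hp) 0
  rw [fwdDiff_iter_eq_sum_shift] at h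
  have h2 : ∑ i ∈ range (M + 1), (-1) ^ i * (M.choose i : ℂ) * p.eval (i : ℂ) =
      (-1) ^ M * ∑ k ∈ range (M + 1),
        ((-1 : ℤ) ^ (M - k) * (M.choose k : ℤ)) • p.eval ((0 : ℂ) + k • (1 : ℂ)) := by
    rw [mul_sum]
    refine sum_congr rfl fun i hi => ?_
    obtain ⟨j, rfl⟩ := Nat.exists_eq_add_of_le (Nat.lt_succ_iff.mp (mem_range.mp hi))
    simp only [zsmul_eq_mul, nsmul_eq_mul, mul_one, zero_add, add_tsub_cancel_left]
    push_cast
    rw [pow_add]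
    have : ((-1 : ℂ) ^ j) * (-1) ^ j = 1 := by rw [← mul_pow]; simp
    linear_combination (-(-1) ^ i * ((i + j).choose i : ℂ) * p.eval (i : ℂ)) * this
  rw [h2, h]
  simp

lemma alternatingChooseSum_eq_zero {M c a b : ℕ} (h : a + b < M) :
    alternatingChooseSum M c a b = 0 := by
  obtain ⟨p, hp, hpe⟩ := exists_polynomial_eval_choose a
  obtain ⟨q, hq, hqe⟩ := exists_polynomial_eval_choose b
  have hdeg : (p.comp (C (M : ℂ) - X) * q.comp (X + C (c : ℂ))).natDegree < M := by
    refine lt_of_le_of_lt (natDegree_mul_le.trans (add_le_add ?_ ?_)) h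
    · refine natDegree_comp_le.trans ?_
      have : (C (M : ℂ) - X).natDegree ≤ 1 :=
        (natDegree_sub_le _ _).trans (by simp)
      nlinarith
    · rw [natDegree_comp, natDegree_X_add_C, mul_one]
      exact hq
  rw [← sum_alternating_choose_mul_eval_eq_zero hdeg, alternatingChooseSum]
  refine sum_congr rfl fun i hi => ?_
  have hi' : i ≤ M := Nat.lt_succ_iff.mp (mem_range.mp hi)
  rw [eval_mul, eval_comp, eval_comp, eval_sub, eval_add, eval_C, eval_X, eval_C,
    ← Nat.cast_sub hi', ← Nat.cast_add, hpe, hqe]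

lemma alternatingChooseSum_zero_ne_zero (d : ℕ) : alternatingChooseSum (d + d) 0 d d ≠ 0 := by
  rw [alternatingChooseSum, sum_eq_single d]
  · simpa using (Nat.choose_pos (Nat.le_add_left d d)).ne'
  · intro i hi hne
    have := mem_range.mp hi
    rcases lt_or_gt_of_ne hne with h | h
    · rw [Nat.choose_eq_zero_of_lt (show i + 0 < d by omega)]
      simp
    · rw [Nat.choose_eq_zero_of_lt (show d + d - i < d by omega)]
      simp
  · intro h
    simp at h

lemma alternatingChooseSum_one_eq_zero_shift (d : ℕ) (hd : 0 < d) :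
    alternatingChooseSum (d + d) 1 d d = alternatingChooseSum (d + d) 0 d d := by
  obtain ⟨l, rfl⟩ := Nat.exists_eq_succ_of_ne_zero hd.ne'
  rw [← sub_eq_zero, ← alternatingChooseSum_eq_zero
    (show l.succ + l < l.succ + l.succ by omega) (c := 0)]
  simp only [alternatingChooseSum, ← sum_sub_distrib]
  refine sum_congr rfl fun i _ => ?_
  rw [Nat.succ_eq_add_one, add_zero, Nat.choose_succ_succ i l]
  push_cast
  ring

end Coefficients

section WittOperators

open Finset

variable {R : Type*} [Ring R] [Algebra ℂ R]

/-- The operator by which `d_{n-1}` acts, when `x` is the coordinate, `A 0` the derivation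
and `A (r + 1)` the action of `d_r` on the coefficients. -/
def wittOp (x : R) (A : ℕ → R) (n : ℕ) : R :=
  ∑ k ∈ range (n + 1), (n.choose k : ℂ) • (x ^ (n - k) * A k)

/-- The finite-difference combination of the products of two Witt operators. -/
def wittDiff (x : R) (A : ℕ → R) (M c : ℕ) : R :=
  ∑ i ∈ range (M + 1), ((-1) ^ i * (M.choose i : ℂ)) • (wittOp x A (M - i) * wittOp x A (i + c))

variable {x : R} {A : ℕ → R}

lemma wittOp_eq_sum_range {d : ℕ} (hA : ∀ k, d < k → A k = 0) (n : ℕ) :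
    wittOp x A n = ∑ k ∈ range (d + 1), (n.choose k : ℂ) • (x ^ (n - k) * A k) := by
  have h1 : wittOp x A n =
      ∑ k ∈ range (max n d + 1), (n.choose k : ℂ) • (x ^ (n - k) * A k) := by
    refine sum_subset (range_mono (by omega)) fun k _ hk => ?_
    rw [Nat.choose_eq_zero_of_lt (by simp at hk; omega)]
    simp
  rw [h1]
  symm
  refine sum_subset (range_mono (by omega)) fun k _ hk => ?_
  rw [hA k (by simp at hk; omega)]
  simp

lemma mul_pow_of_commutator_eq_one {y : R} (h : y * x - x * y = 1) (q : ℕ) :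
    y * x ^ q = x ^ q * y + (q : ℂ) • x ^ (q - 1) := by
  induction q with
  | zero => simp
  | succ q ih =>
    have h' : y * x = x * y + 1 := by rw [← h]; abel
    rw [pow_succ, ← mul_assoc, ih, add_mul, mul_assoc, h', smul_mul_assoc]
    rcases q with _ | q
    · simp
    · simp only [add_tsub_cancel_right, ← pow_succ]
      rw [mul_add, mul_one, ← mul_assoc, ← pow_succ, add_assoc]
      congr 1
      push_cast
      rw [add_smul ((q : ℂ) + 1) 1, one_smul, add_comm]

lemma wittOp_mul_wittOp (h0 : A 0 * x - x * A 0 = 1) (hx : ∀ k, Commute (A (k + 1)) x)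
    {d : ℕ} (hA : ∀ k, d < k → A k = 0) (m n : ℕ) :
    wittOp x A m * wittOp x A n =
      ∑ j ∈ range (d + 1), ∑ k ∈ range (d + 1),
        ((m.choose j : ℂ) * (n.choose k : ℂ)) • (x ^ (m + n - j - k) * A j * A k) +
      ∑ k ∈ range (d + 1),
        ((m.choose 0 : ℂ) * (n.choose (k + 1) : ℂ)) •
          (((k : ℂ) + 1) • (x ^ (m + n - k - 1) * A k)) := by
  have hpow : ∀ j k, ((m.choose j : ℂ) * (n.choose k : ℂ)) • (x ^ (m - j) * x ^ (n - k)) =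
      ((m.choose j : ℂ) * (n.choose k : ℂ)) • x ^ (m + n - j - k) := by
    intro j k
    by_cases hj : m < j
    · simp [Nat.choose_eq_zero_of_lt hj]
    by_cases hk : n < k
    · simp [Nat.choose_eq_zero_of_lt hk]
    rw [← pow_add]
    congr 2
    omega
  have hterm : ∀ j k, ((m.choose (j + 1) : ℂ) • (x ^ (m - (j + 1)) * A (j + 1))) *
      ((n.choose k : ℂ) • (x ^ (n - k) * A k)) =
        ((m.choose (j + 1) : ℂ) * (n.choose k : ℂ)) •
          (x ^ (m + n - (j + 1) - k) * A (j + 1) * A k) := by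
    intro j k
    rw [smul_mul_smul_comm, mul_assoc (x ^ _), ← mul_assoc (A _) (x ^ _),
      ((hx j).pow_right _).eq, mul_assoc (x ^ (n - k)), ← mul_assoc (x ^ (m - _)),
      ← smul_mul_assoc, hpow, smul_mul_assoc, mul_assoc]
  have hterm0 : ∀ k, ((m.choose 0 : ℂ) • (x ^ (m - 0) * A 0)) *
      ((n.choose k : ℂ) • (x ^ (n - k) * A k)) =
        ((m.choose 0 : ℂ) * (n.choose k : ℂ)) • (x ^ (m + n - 0 - k) * A 0 * A k) +
        ((m.choose 0 : ℂ) * (n.choose (k + 1) : ℂ)) •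
          (((k : ℂ) + 1) • (x ^ (m + n - k - 1) * A k)) := by
    intro k
    rw [smul_mul_smul_comm, mul_assoc (x ^ _), ← mul_assoc (A _) (x ^ _),
      mul_pow_of_commutator_eq_one h0, add_mul, mul_add, smul_add]
    congr 1
    · rw [mul_assoc (x ^ (n - k)), ← mul_assoc (x ^ (m - _)),
        ← smul_mul_assoc, hpow, smul_mul_assoc, mul_assoc]
    · rw [smul_mul_assoc, mul_smul_comm, ← mul_assoc, ← pow_add, smul_smul, smul_smul]
      by_cases hk : n < k + 1
      · rw [Nat.choose_eq_zero_of_lt hk]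
        rcases Nat.lt_or_ge n k with h | h
        · simp [Nat.choose_eq_zero_of_lt h]
        · obtain rfl : n = k := by omega
          simp
      · have hc : (n.choose (k + 1) : ℂ) * ((k : ℂ) + 1) = (n.choose k : ℂ) * ((n - k : ℕ) : ℂ) := by
          exact_mod_cast Nat.choose_succ_right_eq n k
        rw [mul_assoc, mul_assoc, hc]
        congr 3
        omega
  rw [wittOp_eq_sum_range hA, wittOp_eq_sum_range hA, sum_mul_sum, sum_range_succ',
    sum_range_succ' (fun j => ∑ k ∈ range (d + 1), _), add_assoc, ← sum_add_distrib]
  simp only [hterm, hterm0]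

lemma wittDiff_eq (h0 : A 0 * x - x * A 0 = 1) (hx : ∀ k, Commute (A (k + 1)) x)
    {d : ℕ} (hd : 1 < d) (hA : ∀ k, d < k → A k = 0) (c : ℕ) :
    wittDiff x A (d + d) c = alternatingChooseSum (d + d) c d d • (x ^ c * A d * A d) := by
  have hterm : ∀ i ∈ range (d + d + 1),
      ((-1) ^ i * ((d + d).choose i : ℂ)) • (wittOp x A (d + d - i) * wittOp x A (i + c)) =
      ∑ j ∈ range (d + 1), ∑ k ∈ range (d + 1),
        ((-1) ^ i * ((d + d).choose i : ℂ) *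
          (((d + d - i).choose j : ℂ) * ((i + c).choose k : ℂ))) •
            (x ^ (d + d + c - j - k) * A j * A k) +
      ∑ k ∈ range (d + 1),
        ((-1) ^ i * ((d + d).choose i : ℂ) *
          (((d + d - i).choose 0 : ℂ) * ((i + c).choose (k + 1) : ℂ))) •
          (((k : ℂ) + 1) • (x ^ (d + d + c - k - 1) * A k)) := by
    intro i hi
    have hN : d + d - i + (i + c) = d + d + c := by
      have := mem_range.mp hi
      omega
    rw [wittOp_mul_wittOp h0 hx hA, hN]
    simp only [smul_add, smul_sum, mul_smul]
  rw [wittDiff, sum_congr rfl hterm, sum_add_distrib, sum_comm, sum_comm (t := range (d + 1))]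
  have hsecond : ∀ k ∈ range (d + 1), ∑ i ∈ range (d + d + 1),
      ((-1) ^ i * ((d + d).choose i : ℂ) *
          (((d + d - i).choose 0 : ℂ) * ((i + c).choose (k + 1) : ℂ))) •
          (((k : ℂ) + 1) • (x ^ (d + d + c - k - 1) * A k)) = 0 := by
    intro k hk
    have := mem_range.mp hk
    rw [← sum_smul, ← alternatingChooseSum, alternatingChooseSum_eq_zero (by omega), zero_smul]
  rw [sum_eq_zero hsecond, add_zero]
  have hfirst : ∀ j, ∑ i ∈ range (d + d + 1), ∑ k ∈ range (d + 1),
        ((-1) ^ i * ((d + d).choose i : ℂ) *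
          (((d + d - i).choose j : ℂ) * ((i + c).choose k : ℂ))) •
            (x ^ (d + d + c - j - k) * A j * A k) =
      ∑ k ∈ range (d + 1), alternatingChooseSum (d + d) c j k •
            (x ^ (d + d + c - j - k) * A j * A k) := by
    intro j
    rw [sum_comm]
    simp only [← sum_smul]
    rfl
  simp only [hfirst]
  rw [sum_eq_single_of_mem d (by simp), sum_eq_single_of_mem d (by simp)]
  · congr 4
    omega
  · intro k hk hne
    have := mem_range.mp hk
    rw [alternatingChooseSum_eq_zero (by omega), zero_smul]
  · intro j hj hne
    have := mem_range.mp hj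
    refine sum_eq_zero fun k hk => ?_
    have := mem_range.mp hk
    rw [alternatingChooseSum_eq_zero (by omega), zero_smul]

variable {R' : Type*} [Ring R'] [Algebra ℂ R'] {x' : R'} {A' : ℕ → R'}

lemma map_wittDiff {Φ : R →ₐ[ℂ] R'} (hΦ : ∀ n, Φ (wittOp x A n) = wittOp x' A' n) (M c : ℕ) :
    Φ (wittDiff x A M c) = wittDiff x' A' M c := by
  simp only [wittDiff, map_sum, map_smul, map_mul, hΦ]

/-- A homomorphism carrying Witt operators to Witt operators cannot lower the top degree. -/
lemma le_of_map_wittOp [Nontrivial R'] {Φ : R →ₐ[ℂ] R'}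
    (hΦ : ∀ n, Φ (wittOp x A n) = wittOp x' A' n)
    (h0 : A 0 * x - x * A 0 = 1) (hx : ∀ k, Commute (A (k + 1)) x)
    (h0' : A' 0 * x' - x' * A' 0 = 1) (hx' : ∀ k, Commute (A' (k + 1)) x')
    {d d' : ℕ} (hd : 1 < d) (hA : ∀ k, d < k → A k = 0) (hA' : ∀ k, d' < k → A' k = 0)
    (hu : IsUnit (A d)) : d ≤ d' := by
  by_contra! hlt
  have h := map_wittDiff hΦ (d + d) 0
  rw [wittDiff_eq h0 hx hd hA, wittDiff_eq h0' hx' hd (fun k hk => hA' k (hlt.trans hk)),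
    hA' d hlt, mul_zero, smul_zero, map_smul,
    smul_eq_zero_iff_right (alternatingChooseSum_zero_ne_zero d), pow_zero, one_mul] at h
  exact ((hu.mul hu).map Φ).ne_zero h

/-- A homomorphism carrying Witt operators to Witt operators preserves the coordinate. -/
lemma map_coordinate_of_map_wittOp {Φ : R →ₐ[ℂ] R'}
    (hΦ : ∀ n, Φ (wittOp x A n) = wittOp x' A' n)
    (h0 : A 0 * x - x * A 0 = 1) (hx : ∀ k, Commute (A (k + 1)) x)
    (h0' : A' 0 * x' - x' * A' 0 = 1) (hx' : ∀ k, Commute (A' (k + 1)) x')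
    {d : ℕ} (hd : 1 < d) (hA : ∀ k, d < k → A k = 0) (hA' : ∀ k, d < k → A' k = 0)
    (hu : IsUnit (A d)) : Φ x = x' := by
  have hne := alternatingChooseSum_zero_ne_zero d
  have h := map_wittDiff hΦ (d + d) 0
  have h1 := map_wittDiff hΦ (d + d) 1
  rw [wittDiff_eq h0 hx hd hA, wittDiff_eq h0' hx' hd hA', map_smul] at h h1
  rw [alternatingChooseSum_one_eq_zero_shift d (by omega)] at h1
  have e := smul_right_injective _ hne h
  have e1 := smul_right_injective _ hne h1
  simp only [pow_zero, one_mul, pow_one, mul_assoc] at e e1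
  rw [map_mul, ← e] at e1
  exact ((hu.mul hu).map Φ).mul_right_cancel e1

/-- A homomorphism carrying Witt operators to Witt operators and the coordinate to the
coordinate carries coefficients to coefficients. -/
lemma map_coefficient_of_map_wittOp {Φ : R →ₐ[ℂ] R'}
    (hΦ : ∀ n, Φ (wittOp x A n) = wittOp x' A' n) (hx : Φ x = x') (k : ℕ) :
    Φ (A k) = A' k := by
  induction k using Nat.strong_induction_on with
  | _ k ih =>
    have h := hΦ k
    rw [wittOp, wittOp, sum_range_succ, sum_range_succ, map_add, map_sum] at h
    have hlow : ∑ j ∈ range k, Φ ((k.choose j : ℂ) • (x ^ (k - j) * A j)) =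
        ∑ j ∈ range k, (k.choose j : ℂ) • (x' ^ (k - j) * A' j) := by
      refine sum_congr rfl fun j hj => ?_
      rw [map_smul, map_mul, map_pow, hx, ih j (mem_range.mp hj)]
    rw [hlow] at h
    simpa using h

end WittOperators

section SimpleModules

/-- Schur's lemma for modules given by families of operators: a nonzero intertwiner
between simple modules is an isomorphism. -/
lemma bijective_of_intertwines {ι M N : Type*} [AddCommGroup M] [Module ℂ M]
    [AddCommGroup N] [Module ℂ N] {a : ι → Module.End ℂ M} {a' : ι → Module.End ℂ N}
    (hM : ∀ U : Submodule ℂ M, (∀ i, ∀ u ∈ U, a i u ∈ U) → U = ⊥ ∨ U = ⊤)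
    (hN : ∀ U : Submodule ℂ N, (∀ i, ∀ u ∈ U, a' i u ∈ U) → U = ⊥ ∨ U = ⊤)
    {f : M →ₗ[ℂ] N} (hf : ∀ i u, f (a i u) = a' i (f u)) (hne : f ≠ 0) :
    Function.Bijective f := by
  constructor
  · refine LinearMap.ker_eq_bot.mp ((hM f.ker fun i u hu => ?_).resolve_right fun h =>
      hne (LinearMap.ker_eq_top.mp h))
    rw [LinearMap.mem_ker] at hu ⊢
    rw [hf, hu, map_zero]
  · refine LinearMap.range_eq_top.mp ((hN f.range fun i u hu => ?_).resolve_left fun h =>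
      hne (LinearMap.range_eq_bot.mp h))
    obtain ⟨v, rfl⟩ := hu
    exact ⟨a i v, hf i v⟩

lemma bijective_top_operator {V : Type*} [AddCommGroup V] [Module ℂ V]
    {b : ℕ → Module.End ℂ V}
    (hb : ∀ r t : ℕ, b r * b t - b t * b r = (((t : ℂ) - (r : ℂ))) • b (r + t))
    (hVne : ∃ v : V, v ≠ 0)
    (hV : ∀ U : Submodule ℂ V, (∀ r : ℕ, ∀ v ∈ U, b r v ∈ U) → U = ⊥ ∨ U = ⊤)
    {l : ℕ} (hinj : Function.Injective (b l)) (hzero : ∀ i : ℕ, l < i → b i = 0) :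
    Function.Bijective (b l) := by
  refine ⟨hinj, LinearMap.range_eq_top.mp ((hV (b l).range fun r u hu => ?_).resolve_left
    fun h => ?_)⟩
  · obtain ⟨v, rfl⟩ := hu
    have h := LinearMap.congr_fun (hb r l) v
    simp only [LinearMap.sub_apply, Module.End.mul_apply, LinearMap.smul_apply] at h
    rw [sub_eq_iff_eq_add] at h
    rw [h]
    refine add_mem ?_ ⟨_, rfl⟩
    rcases Nat.eq_zero_or_pos r with rfl | hr
    · rw [zero_add]
      exact Submodule.smul_mem _ _ ⟨v, rfl⟩
    · rw [hzero (r + l) (by omega)]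
      simp
  · obtain ⟨v, hv⟩ := hVne
    refine hv (hinj ?_)
    rw [LinearMap.range_eq_bot.mp h]
    simp

/-- Coordinates in the right factor separate points of a tensor product and commute with
the operators on the left factor. -/
lemma exists_left_projection {P V : Type*} [AddCommGroup P] [Module ℂ P]
    [AddCommGroup V] [Module ℂ V] {t : P ⊗[ℂ] V} (ht : t ≠ 0) :
    ∃ π : P ⊗[ℂ] V →ₗ[ℂ] P, π t ≠ 0 ∧
      ∀ (f : Module.End ℂ P) (u), π (TensorProduct.map f LinearMap.id u) = f (π u) := by
  classical
  let 𝒞 := Module.Basis.ofVectorSpace ℂ V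
  have h : TensorProduct.equivFinsuppOfBasisRight (M := P) 𝒞 t ≠ 0 := by
    simpa using ht
  obtain ⟨i, hi⟩ := Finsupp.ne_iff.mp h
  refine ⟨Finsupp.lapply i ∘ₗ (TensorProduct.equivFinsuppOfBasisRight (M := P) 𝒞).toLinearMap,
    hi, fun f u => ?_⟩
  induction u with
  | zero => simp
  | add u w hu hw => simp only [map_add, hu, hw]
  | tmul p v => simp

lemma exists_right_projection {P V : Type*} [AddCommGroup P] [Module ℂ P]
    [AddCommGroup V] [Module ℂ V] {t : P ⊗[ℂ] V} (ht : t ≠ 0) :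
    ∃ π : P ⊗[ℂ] V →ₗ[ℂ] V, π t ≠ 0 ∧
      ∀ (f : Module.End ℂ V) (u), π (TensorProduct.map LinearMap.id f u) = f (π u) := by
  classical
  let ℬ := Module.Basis.ofVectorSpace ℂ P
  have h : TensorProduct.equivFinsuppOfBasisLeft (N := V) ℬ t ≠ 0 := by
    simpa using ht
  obtain ⟨i, hi⟩ := Finsupp.ne_iff.mp h
  refine ⟨Finsupp.lapply i ∘ₗ (TensorProduct.equivFinsuppOfBasisLeft (N := V) ℬ).toLinearMap,
    hi, fun f u => ?_⟩
  induction u with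
  | zero => simp
  | add u w hu hw => simp only [map_add, hu, hw]
  | tmul p v => simp

lemma tmul_ne_zero_of_ne_zero {P V : Type*} [AddCommGroup P] [Module ℂ P]
    [AddCommGroup V] [Module ℂ V] {p : P} {v : V} (hp : p ≠ 0) (hv : v ≠ 0) :
    p ⊗ₜ[ℂ] v ≠ 0 := by
  classical
  let 𝒞 := Module.Basis.ofVectorSpace ℂ V
  intro h
  refine hv (𝒞.repr.map_eq_zero_iff.mp (Finsupp.ext fun i => ?_))
  have hi := TensorProduct.equivFinsuppOfBasisRight_apply_tmul_apply 𝒞 p v i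
  rw [h, map_zero, Finsupp.zero_apply] at hi
  exact (smul_eq_zero.mp hi.symm).resolve_right hp

end SimpleModules

section TensorModule

variable {P V : Type} [AddCommGroup P] [Module ℂ P] [AddCommGroup V] [Module ℂ V]

/-- The coefficients of the tensor module operators: the derivation in degree `0`, and the
action of `d_r` on the right factor in degree `r + 1`. -/
def tensorCoefficient (D : Module.End ℂ P) (b : ℕ → Module.End ℂ V) :
    ℕ → Module.End ℂ (P ⊗[ℂ] V)
  | 0 => TensorProduct.map D LinearMap.id
  | r + 1 => TensorProduct.map LinearMap.id (b r)

lemma Td_eq_wittOp (X D : Module.End ℂ P) (b : ℕ → Module.End ℂ V) (n : ℕ) :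
    Td X D b ((n : ℤ) - 1) =
      wittOp (TensorProduct.map X LinearMap.id) (tensorCoefficient D b) n := by
  have hpow : ∀ q : ℕ, (TensorProduct.map X LinearMap.id : Module.End ℂ (P ⊗[ℂ] V)) ^ q =
      TensorProduct.map (X ^ q) LinearMap.id := by
    intro q
    rw [TensorProduct.map_pow]
    congr 1
    exact one_pow q
  rcases n with _ | n
  · simp [Td, wittOp, tensorCoefficient]
  · have h : (((n + 1 : ℕ) : ℤ) - 1) = (n : ℤ) := by push_cast; ring
    rw [h, Td, if_neg (by omega), wittOp, Finset.sum_range_succ' _ (n + 1), add_comm]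
    simp only [Int.toNat_natCast, hpow, tensorCoefficient, Nat.choose_zero_right, Nat.cast_one,
      one_smul, Nat.sub_zero, Nat.add_sub_add_right, ← TensorProduct.map_mul]
    rfl

lemma tensorCoefficient_zero_commutator {X D : Module.End ℂ P} (h : D * X - X * D = 1)
    (b : ℕ → Module.End ℂ V) :
    tensorCoefficient D b 0 * TensorProduct.map X LinearMap.id -
      TensorProduct.map X LinearMap.id * tensorCoefficient D b 0 = 1 := by
  ext p v
  have h' := LinearMap.congr_fun h p
  simp only [LinearMap.sub_apply, Module.End.mul_apply, Module.End.one_apply] at h'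
  simp [tensorCoefficient, ← TensorProduct.sub_tmul, h']

lemma tensorCoefficient_succ_commute (X D : Module.End ℂ P) (b : ℕ → Module.End ℂ V) (k : ℕ) :
    Commute (tensorCoefficient D b (k + 1)) (TensorProduct.map X LinearMap.id) := by
  ext p v
  simp [tensorCoefficient]

lemma tensorCoefficient_eq_zero {b : ℕ → Module.End ℂ V} {l : ℕ}
    (hzero : ∀ i : ℕ, l < i → b i = 0) (D : Module.End ℂ P) (k : ℕ) (hk : l + 1 < k) :
    tensorCoefficient D b k = 0 := by
  obtain ⟨r, rfl⟩ := Nat.exists_eq_succ_of_ne_zero (show k ≠ 0 by omega)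
  simp [tensorCoefficient, hzero r (by omega)]

lemma tensorCoefficient_isUnit {b : ℕ → Module.End ℂ V} {l : ℕ}
    (hbij : Function.Bijective (b l)) (D : Module.End ℂ P) :
    IsUnit (tensorCoefficient D b (l + 1)) :=
  ((Module.End.isUnit_iff (b l)).mpr hbij).map (Module.End.lTensorAlgHom ℂ V P)

/-- An isomorphism of tensor modules intertwines the coordinate and all coefficients. -/
lemma intertwines_of_tensor_iso {P' V' : Type} [AddCommGroup P'] [Module ℂ P']
    [AddCommGroup V'] [Module ℂ V'] {X D : Module.End ℂ P} {X' D' : Module.End ℂ P'}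
    {b : ℕ → Module.End ℂ V} {b' : ℕ → Module.End ℂ V'}
    (hWeyl : D * X - X * D = 1) (hWeyl' : D' * X' - X' * D' = 1)
    {l s : ℕ} (hl : 0 < l) (hs : 0 < s)
    (hbij : Function.Bijective (b l)) (hzero : ∀ i : ℕ, l < i → b i = 0)
    (hbij' : Function.Bijective (b' s)) (hzero' : ∀ i : ℕ, s < i → b' i = 0)
    [Nontrivial (P ⊗[ℂ] V)]
    (F : (P ⊗[ℂ] V) ≃ₗ[ℂ] (P' ⊗[ℂ] V'))
    (hF : ∀ i : ℤ, -1 ≤ i → ∀ t, F (Td X D b i t) = Td X' D' b' i (F t)) :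
    l = s ∧
      (∀ t, F (TensorProduct.map X LinearMap.id t) = TensorProduct.map X' LinearMap.id (F t)) ∧
      ∀ k t, F (tensorCoefficient D b k t) = tensorCoefficient D' b' k (F t) := by
  have : Nontrivial (P' ⊗[ℂ] V') := F.symm.toEquiv.nontrivial
  have hΦ : ∀ n, (F.conjAlgEquiv ℂ : _ →ₐ[ℂ] _)
      (wittOp (TensorProduct.map X LinearMap.id) (tensorCoefficient D b) n) =
      wittOp (TensorProduct.map X' LinearMap.id) (tensorCoefficient D' b') n := by
    intro n
    rw [← Td_eq_wittOp, ← Td_eq_wittOp]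
    refine LinearMap.ext fun t => ?_
    have := hF ((n : ℤ) - 1) (by omega) (F.symm t)
    rw [F.apply_symm_apply] at this
    exact this
  have hΨ : ∀ n, ((F.conjAlgEquiv ℂ).symm : _ →ₐ[ℂ] _)
      (wittOp (TensorProduct.map X' LinearMap.id) (tensorCoefficient D' b') n) =
      wittOp (TensorProduct.map X LinearMap.id) (tensorCoefficient D b) n := fun n =>
    (F.conjAlgEquiv ℂ).symm_apply_eq.mpr (hΦ n).symm
  have h0 := tensorCoefficient_zero_commutator hWeyl b
  have h0' := tensorCoefficient_zero_commutator hWeyl' b'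
  have hx := tensorCoefficient_succ_commute X D b
  have hx' := tensorCoefficient_succ_commute X' D' b'
  have hA := tensorCoefficient_eq_zero hzero D
  have hA' := tensorCoefficient_eq_zero hzero' D'
  have hu := tensorCoefficient_isUnit hbij D
  have hu' := tensorCoefficient_isUnit hbij' D'
  have hle := le_of_map_wittOp hΦ h0 hx h0' hx' (by omega) hA hA' hu
  have hge := le_of_map_wittOp hΨ h0' hx' h0 hx (by omega) hA' hA hu'
  obtain rfl : l = s := by omega
  have hX := map_coordinate_of_map_wittOp hΦ h0 hx h0' hx' (by omega) hA hA' hu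
  have happ : ∀ (f : Module.End ℂ (P ⊗[ℂ] V)) (g : Module.End ℂ (P' ⊗[ℂ] V')),
      (F.conjAlgEquiv ℂ : _ →ₐ[ℂ] _) f = g → ∀ t, F (f t) = g (F t) := by
    rintro f _ rfl t
    simp
  exact ⟨rfl, happ _ _ hX, fun k => happ _ _ (map_coefficient_of_map_wittOp hΦ hX k)⟩

/-- Isomorphisms of both factors induce an isomorphism of tensor modules. -/
lemma congr_Td {P' V' : Type} [AddCommGroup P'] [Module ℂ P']
    [AddCommGroup V'] [Module ℂ V'] {X D : Module.End ℂ P} {X' D' : Module.End ℂ P'}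
    {b : ℕ → Module.End ℂ V} {b' : ℕ → Module.End ℂ V'}
    {g : P ≃ₗ[ℂ] P'} (hX : ∀ p, g (X p) = X' (g p)) (hD : ∀ p, g (D p) = D' (g p))
    {h : V ≃ₗ[ℂ] V'} (hb : ∀ r v, h (b r v) = b' r (h v)) (i : ℤ) (t : P ⊗[ℂ] V) :
    TensorProduct.congr g h (Td X D b i t) = Td X' D' b' i (TensorProduct.congr g h t) := by
  have hpow : ∀ (q : ℕ) p, g ((X ^ q) p) = (X' ^ q) (g p) := by
    intro q
    induction q with
    | zero => simp
    | succ q ih =>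
      intro p
      rw [pow_succ, pow_succ, Module.End.mul_apply, Module.End.mul_apply, ih, hX]
  induction t with
  | zero => simp
  | add u w hu hw => simp only [map_add, hu, hw]
  | tmul p v =>
    unfold Td
    split_ifs
    · simp [hD]
    · simp [LinearMap.sum_apply, hpow, hD, hb]

end TensorModule

/-- With `P, P'` simple Weyl-algebra modules and `V, V'` simple
`𝔟`-modules as in the construction of the tensor modules (with parameters `l` and `s`
respectively), the `𝔚`-modules `T(P,V)` and `T(P',V')` are isomorphic if and only if
`P ≅ P'` as Weyl algebra modules, `l = s`, and `V ≅ V'` as `𝔟`-modules. -/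
theorem tensor_module_iso_criterion
    (P : Type) [AddCommGroup P] [Module ℂ P] (X D : Module.End ℂ P)
    (hWeyl : D * X - X * D = 1)
    (hPne : ∃ p : P, p ≠ 0)
    (hPsimple : ∀ U : Submodule ℂ P,
      (∀ p ∈ U, X p ∈ U) → (∀ p ∈ U, D p ∈ U) → U = ⊥ ∨ U = ⊤)
    (P' : Type) [AddCommGroup P'] [Module ℂ P'] (X' D' : Module.End ℂ P')
    (hWeyl' : D' * X' - X' * D' = 1)
    (hPne' : ∃ p : P', p ≠ 0)
    (hPsimple' : ∀ U : Submodule ℂ P',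
      (∀ p ∈ U, X' p ∈ U) → (∀ p ∈ U, D' p ∈ U) → U = ⊥ ∨ U = ⊤)
    (V : Type) [AddCommGroup V] [Module ℂ V] (b : ℕ → Module.End ℂ V)
    (hb : ∀ r t : ℕ, b r * b t - b t * b r = (((t : ℂ) - (r : ℂ))) • b (r + t))
    (hVne : ∃ v : V, v ≠ 0)
    (hVsimple : ∀ U : Submodule ℂ V, (∀ r : ℕ, ∀ v ∈ U, b r v ∈ U) → U = ⊥ ∨ U = ⊤)
    (V' : Type) [AddCommGroup V'] [Module ℂ V'] (b' : ℕ → Module.End ℂ V')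
    (hb' : ∀ r t : ℕ, b' r * b' t - b' t * b' r = (((t : ℂ) - (r : ℂ))) • b' (r + t))
    (hVne' : ∃ v : V', v ≠ 0)
    (hVsimple' : ∀ U : Submodule ℂ V', (∀ r : ℕ, ∀ v ∈ U, b' r v ∈ U) → U = ⊥ ∨ U = ⊤)
    (l : ℕ) (hl : 0 < l) (hinj : Function.Injective (b l))
    (hzero : ∀ i : ℕ, l < i → b i = 0)
    (s : ℕ) (hs : 0 < s) (hinj' : Function.Injective (b' s))
    (hzero' : ∀ i : ℕ, s < i → b' i = 0) :
    (∃ F : (P ⊗[ℂ] V) ≃ₗ[ℂ] (P' ⊗[ℂ] V'), ∀ i : ℤ, -1 ≤ i → ∀ t : P ⊗[ℂ] V,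
        F (Td X D b i t) = Td X' D' b' i (F t)) ↔
    ((∃ g : P ≃ₗ[ℂ] P', (∀ p, g (X p) = X' (g p)) ∧ (∀ p, g (D p) = D' (g p))) ∧
      l = s ∧
      (∃ h : V ≃ₗ[ℂ] V', ∀ r : ℕ, ∀ v : V, h (b r v) = b' r (h v))) := by
  constructor
  · rintro ⟨F, hF⟩
    obtain ⟨p, hp⟩ := hPne
    obtain ⟨v, hv⟩ := hVne
    have hpv : p ⊗ₜ[ℂ] v ≠ 0 := tmul_ne_zero_of_ne_zero hp hv
    have : Nontrivial (P ⊗[ℂ] V) := ⟨_, _, hpv⟩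
    obtain ⟨hls, hX, hA⟩ := intertwines_of_tensor_iso hWeyl hWeyl' hl hs
      (bijective_top_operator hb ⟨v, hv⟩ hVsimple hinj hzero) hzero
      (bijective_top_operator hb' hVne' hVsimple' hinj' hzero') hzero' F hF
    have hFpv : F (p ⊗ₜ[ℂ] v) ≠ 0 := by simpa using hpv
    refine ⟨?_, hls, ?_⟩
    · obtain ⟨π, hπ, hπf⟩ := exists_left_projection hFpv
      let f : P →ₗ[ℂ] P' := π ∘ₗ F.toLinearMap ∘ₗ (TensorProduct.mk ℂ P V).flip v
      have hfX : ∀ q, f (X q) = X' (f q) := fun q => by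
        have := congrArg π (hX (q ⊗ₜ[ℂ] v))
        rw [hπf] at this
        exact this
      have hfD : ∀ q, f (D q) = D' (f q) := fun q => by
        have := congrArg π (hA 0 (q ⊗ₜ[ℂ] v))
        rw [tensorCoefficient, tensorCoefficient, hπf] at this
        exact this
      have hbij : Function.Bijective f := by
        refine bijective_of_intertwines (ι := Bool) (a := fun i => cond i X D)
          (a' := fun i => cond i X' D') (fun U hU => hPsimple U (hU true) (hU false))
          (fun U hU => hPsimple' U (hU true) (hU false)) ?_ fun h => hπ ?_
        · rintro (_ | _)
          exacts [hfD, hfX]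
        · exact LinearMap.congr_fun h p
      exact ⟨LinearEquiv.ofBijective f hbij, hfX, hfD⟩
    · obtain ⟨π, hπ, hπf⟩ := exists_right_projection hFpv
      let f : V →ₗ[ℂ] V' := π ∘ₗ F.toLinearMap ∘ₗ TensorProduct.mk ℂ P V p
      have hfb : ∀ r w, f (b r w) = b' r (f w) := fun r w => by
        have := congrArg π (hA (r + 1) (p ⊗ₜ[ℂ] w))
        rw [tensorCoefficient, tensorCoefficient, hπf] at this
        exact this
      have hbij : Function.Bijective f :=
        bijective_of_intertwines hVsimple hVsimple' hfb fun h => hπ (LinearMap.congr_fun h v)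
      exact ⟨LinearEquiv.ofBijective f hbij, hfb⟩
  · rintro ⟨⟨g, hgX, hgD⟩, -, h, hh⟩
    exact ⟨TensorProduct.congr g h, fun i _ => congr_Td hgX hgD hh i⟩

end
end
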